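/- arXiv:2309.12724 — 3 statements merged into one kernel-verified Lean document; each statement's English description precedes it below -/
import Mathlib

section
/- For every positive integer p there exists a real number λ_p > 1 such that S_F^{(p)}(N) ≍ N^{(log λ_p)/(log φ)} as N → ∞; that is, there are constants 0 < c ≤ C (possibly depending on p) such that c · N^{(log λ_p)/(log φ)} ≤ S_F^{(p)}(N) ≤ C · N^{(log λ_p)/(log φ)} for all sufficiently large N. -/
/-- The Fibonacci sequence with `f 1 = 1`, `f 2 = 2`, `f (n+2) = f (n+1) + f n`
(the value at `0` is a dummy). -/
def fibS : ℕ → ℕ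
  | 0 => 0
  | 1 => 1
  | 2 => 2
  | n + 3 => fibS (n + 2) + fibS (n + 1)

/-- `rF n` is the number of ways to write `n` as a sum of distinct Fibonacci numbers,
i.e. the number of finite sets `S` of positive integers with `∑ i ∈ S, fibS i = n`. -/
noncomputable def rF (n : ℕ) : ℕ :=
  Nat.card {S : Finset ℕ // 0 ∉ S ∧ ∑ i ∈ S, fibS i = n}

/-- The power sum `S_F^{(p)}(N) = ∑_{n=0}^{N-1} (rF n)^p`. -/
noncomputable def SF (p N : ℕ) : ℕ :=
  ∑ n ∈ Finset.range N, (rF n) ^ p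

/-- The golden ratio. -/
noncomputable def phi : ℝ := (1 + Real.sqrt 5) / 2

open Finset
open scoped goldenRatio

lemma abs_goldenConj : |ψ| = φ - 1 := by
  rw [abs_of_neg Real.goldenConj_neg]
  linarith [Real.goldenRatio_add_goldenConj]

lemma abs_sum_pow_sub_sum_pow_goldenConj_lt (S T : Finset ℕ) :
    |∑ i ∈ S, ψ ^ i - ∑ i ∈ T, ψ ^ i| < φ ^ 2 := by
  obtain ⟨k, hk⟩ := (S ∪ T).exists_nat_subset_range
  have hS : S ⊆ range k := subset_union_left.trans hk
  have hT : T ⊆ range k := subset_union_right.trans hk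
  have hle : |∑ i ∈ S, ψ ^ i - ∑ i ∈ T, ψ ^ i| ≤ ∑ i ∈ range k, |ψ| ^ i := by
    rw [← inter_eq_right.2 hS, ← inter_eq_right.2 hT, ← sum_ite_mem, ← sum_ite_mem,
      ← sum_sub_distrib]
    refine (abs_sum_le_sum_abs _ _).trans (sum_le_sum fun i _ => ?_)
    rw [← abs_pow]
    split_ifs <;> simp
  have hgeom := mul_neg_geom_sum |ψ| k
  have hpos : 0 < |ψ| ^ k := pow_pos (abs_pos.2 Real.goldenConj_ne_zero) k
  rw [abs_goldenConj] at *
  have hsq := Real.goldenRatio_sq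
  have h1 := Real.one_lt_goldenRatio
  have h2 := Real.goldenRatio_lt_two
  nlinarith

lemma int_eq_zero_of_goldenRatio_mul_add_eq_zero {a b : ℤ} (h : φ * a + b = 0) :
    a = 0 ∧ b = 0 := by
  have ha : a = 0 := by
    by_contra ha
    have := (Real.goldenRatio_irrational.mul_intCast ha).add_intCast b
    exact this.ne_zero h
  subst ha
  simpa using h

/-- The linear form through which `φ` and `ψ` see a sum of consecutive powers. -/
lemma sum_pow_succ_eq_of_mul_fib_succ_add_fib {x : ℝ}
    (hx : ∀ n : ℕ, x * Nat.fib (n + 1) + Nat.fib n = x ^ (n + 1)) (S : Finset ℕ) (j : ℕ) :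
    x ^ (j + 1) * ∑ i ∈ S, x ^ i =
      x * ((∑ i ∈ S, Nat.fib (i + j + 1) : ℕ) : ℤ) + ((∑ i ∈ S, Nat.fib (i + j) : ℕ) : ℤ) := by
  push_cast
  rw [mul_sum, mul_sum, ← sum_add_distrib]
  refine sum_congr rfl fun i _ => ?_
  rw [hx]
  ring

lemma sum_pow_goldenRatio_eq_iff (S T : Finset ℕ) :
    ∑ i ∈ S, φ ^ i = ∑ i ∈ T, φ ^ i ↔
      ∑ i ∈ S, Nat.fib (i + 2) = ∑ i ∈ T, Nat.fib (i + 2) := by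
  have hφ := fun S => sum_pow_succ_eq_of_mul_fib_succ_add_fib
    Real.goldenRatio_mul_fib_succ_add_fib S 1
  have hψ := fun S => sum_pow_succ_eq_of_mul_fib_succ_add_fib
    Real.goldenConj_mul_fib_succ_add_fib S 1
  have hφS := hφ S
  have hφT := hφ T
  have hψS := hψ S
  have hψT := hψ T
  simp only [add_assoc, Nat.reduceAdd] at hφS hφT hψS hψT
  set a := ∑ i ∈ S, Nat.fib (i + 2)
  set a' := ∑ i ∈ T, Nat.fib (i + 2)
  set b := ∑ i ∈ S, Nat.fib (i + 1)
  set b' := ∑ i ∈ T, Nat.fib (i + 1)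
  constructor
  · intro h
    rw [h, hφT] at hφS
    have := int_eq_zero_of_goldenRatio_mul_add_eq_zero (a := (a : ℤ) - a') (b := (b : ℤ) - b')
      (by push_cast at hφS ⊢; linarith)
    omega
  · intro h
    have hlt := abs_sum_pow_sub_sum_pow_goldenConj_lt S T
    have hb : |((b - b' : ℤ) : ℝ)| < 1 := by
      have : ((b - b' : ℤ) : ℝ) = ψ ^ 2 * (∑ i ∈ S, ψ ^ i - ∑ i ∈ T, ψ ^ i) := by
        rw [mul_sub, hψS, hψT, h]
        push_cast
        ring
      rw [this, abs_mul, abs_pow]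
      calc |ψ| ^ 2 * _ < |ψ| ^ 2 * φ ^ 2 := by
            have := abs_pos.2 Real.goldenConj_ne_zero
            gcongr
        _ = 1 := by
            rw [sq_abs, ← mul_pow, Real.goldenConj_mul_goldenRatio]
            norm_num
    have hb' : b = b' := by
      have : |(b - b' : ℤ)| < 1 := by exact_mod_cast hb
      rw [Int.abs_lt_one_iff] at this
      omega
    rw [h, hb', ← hφT] at hφS
    exact mul_left_cancel₀ (pow_ne_zero _ Real.goldenRatio_ne_zero) hφS

lemma one_lt_goldenRatio_sq_mul_abs_sum_pow_sub {S T : Finset ℕ}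
    (h : ∑ i ∈ S, φ ^ i ≠ ∑ i ∈ T, φ ^ i) :
    1 < φ ^ 2 * |∑ i ∈ S, φ ^ i - ∑ i ∈ T, φ ^ i| := by
  have hφ := fun S => sum_pow_succ_eq_of_mul_fib_succ_add_fib
    Real.goldenRatio_mul_fib_succ_add_fib S 0
  have hψ := fun S => sum_pow_succ_eq_of_mul_fib_succ_add_fib
    Real.goldenConj_mul_fib_succ_add_fib S 0
  have hφS := hφ S
  have hφT := hφ T
  have hψS := hψ S
  have hψT := hψ T
  simp only [zero_add, add_zero, pow_one] at hφS hφT hψS hψT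
  set a := ∑ i ∈ S, Nat.fib (i + 1)
  set a' := ∑ i ∈ T, Nat.fib (i + 1)
  set b := ∑ i ∈ S, Nat.fib i
  set b' := ∑ i ∈ T, Nat.fib i
  set α := ∑ i ∈ S, φ ^ i - ∑ i ∈ T, φ ^ i with hα
  have hlt := abs_sum_pow_sub_sum_pow_goldenConj_lt S T
  set β := ∑ i ∈ S, ψ ^ i - ∑ i ∈ T, ψ ^ i with hβ
  have h1 : φ * α = φ * ((a - a' : ℤ) : ℝ) + ((b - b' : ℤ) : ℝ) := by
    push_cast at *; linarith
  have h2 : ψ * β = ψ * ((a - a' : ℤ) : ℝ) + ((b - b' : ℤ) : ℝ) := by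
    push_cast at *; linarith
  generalize ((a : ℤ) - a') = u at h1 h2
  generalize ((b : ℤ) - b') = v at h1 h2
  have hα0 : 0 < |α| := abs_pos.2 (sub_ne_zero.2 h)
  have hprod : α * β = ((u ^ 2 - u * v - v ^ 2 : ℤ) : ℝ) := by
    have : (φ * α) * (ψ * β) = -(α * β) := by
      linear_combination α * β * Real.goldenRatio_mul_goldenConj
    rw [h1, h2] at this
    push_cast
    linear_combination this - (u ^ 2 : ℝ) * Real.goldenRatio_mul_goldenConj -
      (u * v : ℝ) * Real.goldenRatio_add_goldenConj
  have hβ0 : β ≠ 0 := by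
    intro hβ0
    rw [hβ0, mul_zero] at h2
    have hψ : ψ = 1 - φ := by linarith [Real.goldenRatio_add_goldenConj]
    have := int_eq_zero_of_goldenRatio_mul_add_eq_zero (a := -u) (b := u + v)
      (by rw [hψ] at h2; push_cast; linarith)
    obtain rfl : u = 0 := by omega
    obtain rfl : v = 0 := by omega
    have : α = 0 :=
      (mul_eq_zero.1 (h1.trans (by simp))).resolve_left Real.goldenRatio_ne_zero
    simp [this] at hα0
  have hone : 1 ≤ |α| * |β| := by
    have hne : (u ^ 2 - u * v - v ^ 2 : ℤ) ≠ 0 := by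
      intro h0
      rw [h0, Int.cast_zero] at hprod
      rcases mul_eq_zero.1 hprod with h | h
      · simp [h] at hα0
      · exact hβ0 h
    rw [← abs_mul, hprod]
    exact_mod_cast Int.one_le_abs hne
  nlinarith

/-- The number of `S ⊆ {0, …, k - 1}` with `∑ i ∈ S, φ ^ i = x`. -/
noncomputable def goldenRep (k : ℕ) (x : ℝ) : ℕ :=
  #{S ∈ (range k).powerset | ∑ i ∈ S, φ ^ i = x}

/-- The values of the sums `∑ i ∈ S, φ ^ i` for `S ⊆ {0, …, k - 1}`. -/
noncomputable def goldenSums (k : ℕ) : Finset ℝ :=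
  (range k).powerset.image fun S => ∑ i ∈ S, φ ^ i

/-- The `p`-th moment of `goldenRep k`. -/
noncomputable def goldenMoment (p k : ℕ) : ℕ :=
  ∑ x ∈ goldenSums k, goldenRep k x ^ p

lemma goldenRep_pos_iff {k : ℕ} {x : ℝ} : 0 < goldenRep k x ↔ x ∈ goldenSums k := by
  simp [goldenRep, goldenSums, card_pos, Finset.Nonempty]

lemma goldenRep_eq_zero {k : ℕ} {x : ℝ} (h : x ∉ goldenSums k) : goldenRep k x = 0 := by
  rwa [← goldenRep_pos_iff, Nat.pos_iff_ne_zero, not_not] at h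

lemma goldenRep_add (m n : ℕ) (x : ℝ) :
    goldenRep (m + n) x =
      ∑ h ∈ goldenSums n, goldenRep m (x - φ ^ m * h) * goldenRep n h := by
  have hmaps : ∀ q ∈ ({q ∈ (range m).powerset ×ˢ (range n).powerset |
      ∑ i ∈ q.1, φ ^ i + φ ^ m * ∑ i ∈ q.2, φ ^ i = x} : Finset (Finset ℕ × Finset ℕ)),
      ∑ i ∈ q.2, φ ^ i ∈ goldenSums n := by
    intro q hq
    rw [mem_filter, mem_product] at hq
    exact mem_image_of_mem _ hq.1.2
  trans #{q ∈ (range m).powerset ×ˢ (range n).powerset |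
      ∑ i ∈ q.1, φ ^ i + φ ^ m * ∑ i ∈ q.2, φ ^ i = x}
  · symm
    refine card_nbij' (fun q => q.1 ∪ q.2.map (addLeftEmbedding m))
      (fun U => (U ∩ range m, {i ∈ range n | m + i ∈ U})) ?_ ?_ ?_ ?_
    · rintro ⟨S, T⟩ hq
      simp only [coe_filter, mem_product, mem_powerset, Set.mem_ofPred_eq] at hq ⊢
      obtain ⟨⟨hS, hT⟩, hx⟩ := hq
      refine ⟨?_, ?_⟩
      · intro i hi
        simp only [mem_union, mem_map, addLeftEmbedding_apply] at hi
        rcases hi with hi | ⟨j, hj, rfl⟩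
        · have := mem_range.1 (hS hi); simp; omega
        · have := mem_range.1 (hT hj); simp; omega
      · rw [sum_union, sum_map, ← hx, mul_sum]
        · simp [pow_add]
        · rw [disjoint_left]
          intro i hi hi'
          simp only [mem_map, addLeftEmbedding_apply] at hi'
          obtain ⟨j, hj, rfl⟩ := hi'
          have := mem_range.1 (hS hi); omega
    · intro U hU
      simp only [coe_filter, mem_product, mem_powerset, Set.mem_ofPred_eq] at hU ⊢
      obtain ⟨hU, hx⟩ := hU
      refine ⟨⟨inter_subset_right, filter_subset _ _⟩, ?_⟩
      rw [← hx, inter_comm, ← sum_ite_mem, sum_filter, mul_sum]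
      rw [← inter_eq_right.2 hU, ← sum_ite_mem, sum_range_add, inter_eq_right.2 hU]
      simp [pow_add]
    · rintro ⟨S, T⟩ hq
      simp only [coe_filter, mem_product, mem_powerset, Set.mem_ofPred_eq] at hq
      obtain ⟨⟨hS, hT⟩, -⟩ := hq
      ext i
      · simp only [mem_inter, mem_union, mem_map, addLeftEmbedding_apply, mem_range]
        constructor
        · rintro ⟨h | ⟨j, -, rfl⟩, h'⟩
          · exact h
          · omega
        · exact fun h => ⟨.inl h, mem_range.1 (hS h)⟩
      · simp only [mem_filter, mem_union, mem_map, addLeftEmbedding_apply, mem_range]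
        constructor
        · rintro ⟨h', h | ⟨j, hj, hij⟩⟩
          · have := mem_range.1 (hS h); omega
          · obtain rfl : j = i := by omega
            exact hj
        · exact fun h => ⟨mem_range.1 (hT h), .inr ⟨i, h, rfl⟩⟩
    · intro U hU
      simp only [coe_filter, mem_powerset, Set.mem_ofPred_eq] at hU
      ext i
      simp only [mem_union, mem_inter, mem_map, mem_filter, mem_range, addLeftEmbedding_apply]
      constructor
      · rintro (h | ⟨j, h, rfl⟩)
        · exact h.1
        · exact h.2
      · intro h
        have := mem_range.1 (hU.1 h)
        rcases lt_or_ge i m with hi | hi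
        · exact .inl ⟨h, hi⟩
        · obtain ⟨j, rfl⟩ := Nat.exists_eq_add_of_le hi
          exact .inr ⟨j, ⟨by omega, h⟩, rfl⟩
  · rw [card_eq_sum_card_fiberwise hmaps]
    refine sum_congr rfl fun h _ => ?_
    rw [goldenRep, goldenRep, ← card_product]
    congr 1
    ext q
    simp only [mem_filter, mem_product]
    constructor
    · rintro ⟨⟨⟨h1, h2⟩, h3⟩, h4⟩
      exact ⟨⟨h1, by rw [← h3, h4]; ring⟩, h2, h4⟩
    · rintro ⟨⟨h1, h2⟩, h3, h4⟩
      exact ⟨⟨⟨h1, h3⟩, by rw [h2, h4]; ring⟩, h4⟩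

lemma add_mem_goldenSums {m n : ℕ} {l h : ℝ} (hl : l ∈ goldenSums m) (hh : h ∈ goldenSums n) :
    l + φ ^ m * h ∈ goldenSums (m + n) := by
  rw [← goldenRep_pos_iff, goldenRep_add]
  refine sum_pos' (fun _ _ => Nat.zero_le _) ⟨h, hh, ?_⟩
  rw [add_sub_cancel_right]
  exact Nat.mul_pos (goldenRep_pos_iff.2 hl) (goldenRep_pos_iff.2 hh)

lemma goldenMoment_mul {p : ℕ} (hp : 0 < p) (m n : ℕ) :
    goldenMoment p m * goldenMoment p n = ∑ x ∈ goldenSums (m + n), ∑ h ∈ goldenSums n,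
      (goldenRep m (x - φ ^ m * h) * goldenRep n h) ^ p := by
  rw [sum_comm, mul_comm, goldenMoment, sum_mul]
  refine sum_congr rfl fun h hh => ?_
  simp_rw [mul_pow, ← sum_mul]
  rw [mul_comm, goldenMoment]
  congr 1
  calc _ = ∑ x ∈ (goldenSums m).image (· + φ ^ m * h), goldenRep m (x - φ ^ m * h) ^ p := by
        rw [sum_image (fun _ _ _ _ => add_right_cancel)]
        simp
    _ = _ := by
        refine sum_subset ?_ fun x _ hx => ?_
        · intro x hx
          obtain ⟨l, hl, rfl⟩ := mem_image.1 hx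
          exact add_mem_goldenSums hl hh
        · rw [goldenRep_eq_zero, zero_pow hp.ne']
          exact fun hl => hx (mem_image.2 ⟨_, hl, by ring⟩)

lemma sum_pow_le_pow_sum {ι : Type*} (s : Finset ι) (f : ι → ℕ) {p : ℕ} (hp : 0 < p) :
    ∑ i ∈ s, f i ^ p ≤ (∑ i ∈ s, f i) ^ p := by
  obtain ⟨q, rfl⟩ := Nat.exists_eq_succ_of_ne_zero hp.ne'
  simp_rw [Nat.succ_eq_add_one, pow_succ]
  rw [mul_sum]
  refine sum_le_sum fun i hi => ?_
  gcongr
  exact single_le_sum (fun _ _ => Nat.zero_le _) hi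

lemma goldenMoment_mul_le {p : ℕ} (hp : 0 < p) (m n : ℕ) :
    goldenMoment p m * goldenMoment p n ≤ goldenMoment p (m + n) := by
  rw [goldenMoment_mul hp, goldenMoment]
  refine sum_le_sum fun x _ => ?_
  rw [goldenRep_add]
  exact sum_pow_le_pow_sum _ _ hp

lemma nonneg_and_lt_of_mem_goldenSums {m : ℕ} {x : ℝ} (hx : x ∈ goldenSums m) :
    0 ≤ x ∧ x < φ ^ m * φ := by
  obtain ⟨S, hS, rfl⟩ := mem_image.1 hx
  have h0 : ∀ i, 0 ≤ φ ^ i := fun i => pow_nonneg Real.goldenRatio_pos.le i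
  refine ⟨sum_nonneg fun i _ => h0 i, ?_⟩
  have h1 := sum_le_sum_of_subset_of_nonneg (mem_powerset.1 hS) fun i _ _ => h0 i
  have h2 := mul_neg_geom_sum φ m
  have h3 : (φ - 1) * φ = 1 := by linarith [Real.goldenRatio_sq]
  have h4 : ∑ i ∈ range m, φ ^ i = φ * (φ ^ m - 1) := by
    linear_combination -φ * h2 - (∑ i ∈ range m, φ ^ i) * h3
  nlinarith [Real.goldenRatio_pos]

lemma card_filter_goldenSums_le (m n : ℕ) (x : ℝ) :
    #{h ∈ goldenSums n | x - φ ^ m * h ∈ goldenSums m} ≤ 7 := by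
  have hpos : 0 < φ ^ m := pow_pos Real.goldenRatio_pos m
  have hφ2 := Real.goldenRatio_lt_two
  set y := x / φ ^ m with hy
  have hxy : x = φ ^ m * y := by rw [hy]; field_simp
  have hwindow : ∀ h, x - φ ^ m * h ∈ goldenSums m → h ≤ y ∧ y - 2 ≤ h := by
    intro h hh
    obtain ⟨h1, h2⟩ := nonneg_and_lt_of_mem_goldenSums hh
    rw [hxy, ← mul_sub] at h1 h2
    have h3 := nonneg_of_mul_nonneg_right h1 hpos
    have h4 := lt_of_mul_lt_mul_left h2 hpos.le
    constructor <;> linarith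
  calc _ ≤ #(Icc (⌊3 * y⌋ - 6) ⌊3 * y⌋) := by
        refine card_le_card_of_injOn (fun h => ⌊3 * h⌋) ?_ ?_
        · intro h hh
          obtain ⟨h1, h2⟩ := hwindow h (mem_filter.1 hh).2
          rw [coe_Icc, Set.mem_Icc]
          refine ⟨?_, Int.floor_le_floor (by linarith)⟩
          have := Int.floor_le_floor (show 3 * y - (6 : ℤ) ≤ 3 * h by push_cast; linarith)
          rwa [Int.floor_sub_intCast] at this
        · intro h hh h' hh' heq
          obtain ⟨S, -, rfl⟩ := mem_image.1 (mem_filter.1 hh).1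
          obtain ⟨T, -, rfl⟩ := mem_image.1 (mem_filter.1 hh').1
          by_contra hne
          have h1 := one_lt_goldenRatio_sq_mul_abs_sum_pow_sub hne
          have h2 := Int.abs_sub_lt_one_of_floor_eq_floor heq
          rw [← mul_sub, abs_mul, abs_of_pos (three_pos)] at h2
          have h3 := abs_nonneg (∑ i ∈ S, φ ^ i - ∑ i ∈ T, φ ^ i)
          nlinarith [Real.goldenRatio_sq]
    _ = 7 := by
        rw [Int.card_Icc]
        omega

lemma goldenMoment_add_le {p : ℕ} (hp : 0 < p) (m n : ℕ) :
    goldenMoment p (m + n) ≤ 7 ^ p * (goldenMoment p m * goldenMoment p n) := by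
  rw [goldenMoment_mul hp, goldenMoment, mul_sum]
  refine sum_le_sum fun x _ => ?_
  set s := {h ∈ goldenSums n | x - φ ^ m * h ∈ goldenSums m}
  have hrep : goldenRep (m + n) x = ∑ h ∈ s, goldenRep m (x - φ ^ m * h) * goldenRep n h := by
    rw [goldenRep_add, sum_filter_of_ne]
    intro h _ hne
    exact goldenRep_pos_iff.1 (Nat.pos_of_ne_zero (left_ne_zero_of_mul hne))
  obtain ⟨q, rfl⟩ := Nat.exists_eq_succ_of_ne_zero hp.ne'
  rw [hrep]
  calc _ ≤ #s ^ q * ∑ h ∈ s, (goldenRep m (x - φ ^ m * h) * goldenRep n h) ^ (q + 1) :=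
        pow_sum_le_card_mul_sum_pow (fun _ _ => Nat.zero_le _) q
    _ ≤ _ := by
        refine Nat.mul_le_mul ?_ (sum_le_sum_of_subset (filter_subset _ _))
        calc #s ^ q ≤ 7 ^ q := Nat.pow_le_pow_left (card_filter_goldenSums_le m n x) q
          _ ≤ 7 ^ (q + 1) := Nat.pow_le_pow_right (by norm_num) (Nat.le_succ q)

lemma two_pow_le_goldenMoment {p : ℕ} (hp : 0 < p) (k : ℕ) : 2 ^ k ≤ goldenMoment p k := by
  rw [← card_range k, ← card_powerset, card_eq_sum_card_image (fun S => ∑ i ∈ S, φ ^ i),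
    card_range]
  exact sum_le_sum fun x _ => Nat.le_self_pow hp.ne' _

/-- The number of `S ⊆ {0, …, k - 1}` with `∑ i ∈ S, fib (i + 2) = n`. -/
def fibRep (k n : ℕ) : ℕ :=
  #{S ∈ (range k).powerset | ∑ i ∈ S, Nat.fib (i + 2) = n}

lemma goldenMoment_eq_sum_fibRep {p : ℕ} (hp : 0 < p) (k : ℕ) :
    goldenMoment p k =
      ∑ n ∈ (range k).powerset.image (fun S => ∑ i ∈ S, Nat.fib (i + 2)), fibRep k n ^ p := by
  obtain ⟨q, rfl⟩ := Nat.exists_eq_succ_of_ne_zero hp.ne'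
  have h1 := sum_comp (s := (range k).powerset) (fun x => goldenRep k x ^ q)
    (fun S => ∑ i ∈ S, φ ^ i)
  have h2 := sum_comp (s := (range k).powerset) (fun n => fibRep k n ^ q)
    (fun S => ∑ i ∈ S, Nat.fib (i + 2))
  simp only [smul_eq_mul] at h1 h2
  simp_rw [Nat.succ_eq_add_one, goldenMoment, pow_succ']
  refine h1.symm.trans (Eq.trans ?_ h2)
  simp_rw [goldenRep, fibRep, sum_pow_goldenRatio_eq_iff]

lemma fibS_succ (i : ℕ) : fibS (i + 1) = Nat.fib (i + 2) := by
  induction i using Nat.strong_induction_on with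
  | _ i ih =>
    match i with
    | 0 => rfl
    | 1 => rfl
    | i + 2 =>
      rw [Nat.fib_add_two, fibS, ih i (by omega), ih (i + 1) (by omega), add_comm]

lemma sum_fibS_map_addRight (S : Finset ℕ) :
    ∑ i ∈ S.map (addRightEmbedding 1), fibS i = ∑ i ∈ S, Nat.fib (i + 2) := by
  rw [sum_map]
  exact sum_congr rfl fun i _ => fibS_succ i

lemma rF_eq_fibRep {k n : ℕ} (hn : n < Nat.fib (k + 2)) : rF n = fibRep k n := by
  rw [rF, fibRep, ← card_map (mapEmbedding (addRightEmbedding 1)).toEmbedding]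
  refine Nat.subtype_card _ fun T => ?_
  simp only [mem_map, mem_filter, mem_powerset, RelEmbedding.coe_toEmbedding, mapEmbedding_apply]
  constructor
  · rintro ⟨S, ⟨-, hS⟩, rfl⟩
    exact ⟨by simp, by rw [sum_fibS_map_addRight, hS]⟩
  · rintro ⟨h0, hT⟩
    have hmap : ({i ∈ range k | i + 1 ∈ T} : Finset ℕ).map (addRightEmbedding 1) = T := by
      ext i
      simp only [mem_map, mem_filter, mem_range, addRightEmbedding_apply]
      constructor
      · rintro ⟨j, ⟨-, hj⟩, rfl⟩
        exact hj
      · intro hi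
        obtain ⟨j, rfl⟩ := Nat.exists_eq_succ_of_ne_zero (ne_of_mem_of_not_mem hi h0)
        refine ⟨j, ⟨?_, hi⟩, rfl⟩
        have hle : fibS (j + 1) ≤ n :=
          hT ▸ single_le_sum (f := fibS) (fun _ _ => Nat.zero_le _) hi
        rw [fibS_succ] at hle
        by_contra! hkj
        have := Nat.fib_mono (show k + 2 ≤ j + 2 by omega)
        omega
    refine ⟨_, ⟨filter_subset _ _, ?_⟩, hmap⟩
    rw [← sum_fibS_map_addRight, hmap, hT]

lemma sum_fib_add_two_lt {k : ℕ} {S : Finset ℕ} (hS : S ⊆ range k) :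
    ∑ i ∈ S, Nat.fib (i + 2) < Nat.fib (k + 3) := by
  have h1 : ∀ k, ∑ i ∈ range k, Nat.fib (i + 2) + 2 = Nat.fib (k + 3) := by
    intro k
    induction k with
    | zero => rfl
    | succ k ih =>
      rw [sum_range_succ, show k + 1 + 3 = k + 2 + 2 by ring, Nat.fib_add_two (n := k + 2),
        show k + 2 + 1 = k + 3 from rfl]
      omega
  have h2 := sum_le_sum_of_subset (f := fun i => Nat.fib (i + 2)) hS
  have := h1 k
  omega

lemma goldenMoment_le_SF {p : ℕ} (hp : 0 < p) (k : ℕ) :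
    goldenMoment p k ≤ SF p (Nat.fib (k + 3)) := by
  rw [goldenMoment_eq_sum_fibRep hp, SF]
  have hlt : ∀ n ∈ (range k).powerset.image (fun S => ∑ i ∈ S, Nat.fib (i + 2)),
      n < Nat.fib (k + 3) := by
    intro n hn
    obtain ⟨S, hS, rfl⟩ := mem_image.1 hn
    exact sum_fib_add_two_lt (mem_powerset.1 hS)
  calc _ ≤ ∑ n ∈ (range k).powerset.image (fun S => ∑ i ∈ S, Nat.fib (i + 2)), rF n ^ p := by
        refine sum_le_sum fun n hn => Nat.pow_le_pow_left ?_ p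
        rw [rF_eq_fibRep (k := k + 1) (hlt n hn)]
        exact card_le_card (filter_subset_filter _ (powerset_mono.2 (range_mono (Nat.le_succ k))))
    _ ≤ _ := sum_le_sum_of_subset fun n hn => mem_range.2 (hlt n hn)

lemma SF_le_goldenMoment {p : ℕ} (hp : 0 < p) (k : ℕ) :
    SF p (Nat.fib (k + 2)) ≤ goldenMoment p k := by
  rw [goldenMoment_eq_sum_fibRep hp, SF]
  calc _ = ∑ n ∈ range (Nat.fib (k + 2)), fibRep k n ^ p :=
        sum_congr rfl fun n hn => by rw [rF_eq_fibRep (mem_range.1 hn)]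
    _ ≤ _ := by
        refine sum_le_sum_of_ne_zero fun n _ hne => ?_
        obtain ⟨S, hS⟩ := card_ne_zero.1 (ne_zero_pow hp.ne' hne)
        exact mem_image.2 ⟨S, mem_filter.1 hS⟩

lemma SF_mono (p : ℕ) : Monotone (SF p) := fun _ _ h =>
  sum_le_sum_of_subset (range_mono h)

/-- A sequence that is multiplicative up to a constant factor grows like a geometric sequence. -/
lemma exists_pow_le_mul_and_le_pow {a : ℕ → ℝ} {K : ℝ} (ha : ∀ n, 1 ≤ a n)
    (hsup : ∀ m n, a m * a n ≤ a (m + n)) (hsub : ∀ m n, a (m + n) ≤ K * (a m * a n)) :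
    ∃ r : ℝ, 0 < r ∧ ∀ n, r ^ n ≤ K * a n ∧ a n ≤ r ^ n := by
  have hpos : ∀ n, 0 < a n := fun n => one_pos.trans_le (ha n)
  have hK : 1 ≤ K := by
    have h1 := (hsup 0 0).trans (hsub 0 0)
    exact le_of_mul_le_mul_right (by simpa using h1) (mul_pos (hpos 0) (hpos 0))
  have hK0 : 0 < K := one_pos.trans_le hK
  have hu : Subadditive fun n => Real.log (K * a n) := by
    intro m n
    rw [← Real.log_mul (mul_pos hK0 (hpos m)).ne' (mul_pos hK0 (hpos n)).ne']
    refine Real.log_le_log (mul_pos hK0 (hpos _)) ?_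
    calc K * a (m + n) ≤ K * (K * (a m * a n)) := by gcongr; exact hsub m n
      _ = _ := by ring
  have hbdd : BddBelow (Set.range fun n : ℕ => Real.log (K * a n) / n) := by
    refine ⟨0, ?_⟩
    rintro _ ⟨n, rfl⟩
    exact div_nonneg (Real.log_nonneg (one_le_mul_of_one_le_of_one_le hK (ha n))) n.cast_nonneg
  have hpow : ∀ n j, a n ^ (j + 1) ≤ a (n * (j + 1)) := by
    intro n j
    induction j with
    | zero => simp
    | succ j ih =>
      calc a n ^ (j + 1 + 1) = a n ^ (j + 1) * a n := pow_succ _ _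
        _ ≤ a (n * (j + 1)) * a n := by gcongr; exact (hpos n).le
        _ ≤ a (n * (j + 1) + n) := hsup _ _
        _ = _ := by ring_nf
  have ha0 : a 0 = 1 := by
    have := hsup 0 0
    nlinarith [ha 0, hpos 0]
  refine ⟨Real.exp hu.lim, Real.exp_pos _, fun n => ?_⟩
  rcases Nat.eq_zero_or_pos n with rfl | hn
  · simp [ha0, hK]
  have hn' : (0 : ℝ) < n := by exact_mod_cast hn
  constructor
  · have := hu.lim_le_div hbdd hn.ne'
    rw [le_div_iff₀ hn', Real.le_log_iff_exp_le (mul_pos hK0 (hpos n))] at this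
    rwa [← Real.exp_nat_mul, mul_comm]
  · rw [← Real.exp_nat_mul, mul_comm, ← Real.log_le_iff_le_exp (hpos n), ← div_le_iff₀ hn']
    have hsubseq : Filter.Tendsto (fun j : ℕ => n * (j + 1)) Filter.atTop Filter.atTop :=
      Filter.tendsto_atTop_mono
        (fun j => (Nat.le_succ j).trans (Nat.le_mul_of_pos_left _ hn)) Filter.tendsto_id
    refine ge_of_tendsto' ((hu.tendsto_lim hbdd).comp hsubseq) fun j => ?_
    have hj : (0 : ℝ) < j + 1 := by positivity
    simp only [Function.comp_apply]
    push_cast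
    rw [← mul_div_mul_right _ _ hj.ne']
    gcongr
    calc Real.log (a n) * (j + 1) = Real.log (a n ^ (j + 1)) := by
          rw [Real.log_pow]; push_cast; ring
      _ ≤ _ := Real.log_le_log (pow_pos (hpos n) _)
          ((hpow n j).trans (le_mul_of_one_le_left (hpos _).le hK))

lemma goldenRatio_pow_le_fib (n : ℕ) : φ ^ n ≤ Nat.fib (n + 2) := by
  induction n using Nat.strong_induction_on with
  | _ n ih =>
    match n with
    | 0 => simp
    | 1 => simpa [Nat.fib_add_two] using Real.goldenRatio_lt_two.le
    | n + 2 =>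
      have h1 := ih n (by omega)
      have h2 := ih (n + 1) (by omega)
      have h3 := Real.goldenRatio_pow_sub_goldenRatio_pow n
      rw [Nat.fib_add_two]
      push_cast
      linarith

lemma fib_succ_le_goldenRatio_pow (n : ℕ) : (Nat.fib (n + 1) : ℝ) ≤ φ ^ n := by
  induction n using Nat.strong_induction_on with
  | _ n ih =>
    match n with
    | 0 => simp
    | 1 => simpa using Real.one_lt_goldenRatio.le
    | n + 2 =>
      have h1 := ih n (by omega)
      have h2 := ih (n + 1) (by omega)
      have h3 := Real.goldenRatio_pow_sub_goldenRatio_pow n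
      rw [Nat.fib_add_two]
      push_cast
      linarith

lemma pow_rpow_log_div_log {b r : ℝ} (hb : 1 < b) (hr : 0 < r) (k : ℕ) :
    (b ^ k) ^ (Real.log r / Real.log b) = r ^ k := by
  have hb0 : 0 < b := one_pos.trans hb
  rw [← Real.rpow_natCast, ← Real.rpow_mul hb0.le, mul_comm, Real.rpow_mul hb0.le,
    Real.rpow_def_of_pos hb0, mul_div_cancel₀ _ (Real.log_pos hb).ne', Real.exp_log hr,
    Real.rpow_natCast]

theorem SF_asymp (p : ℕ) (hp : 0 < p) :
    ∃ lam : ℝ, 1 < lam ∧ ∃ c C : ℝ, 0 < c ∧ c ≤ C ∧ ∃ N₀ : ℕ, ∀ N : ℕ, N₀ ≤ N →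
      c * (N : ℝ) ^ (Real.log lam / Real.log phi) ≤ (SF p N : ℝ) ∧
      (SF p N : ℝ) ≤ C * (N : ℝ) ^ (Real.log lam / Real.log phi) := by
  have htwo : ∀ n, (2 : ℝ) ^ n ≤ goldenMoment p n := fun n => by
    exact_mod_cast two_pow_le_goldenMoment hp n
  obtain ⟨r, hr0, hr⟩ := exists_pow_le_mul_and_le_pow (a := fun n => (goldenMoment p n : ℝ))
    (K := 7 ^ p) (fun n => (one_le_pow₀ one_le_two).trans (htwo n))
    (fun m n => by exact_mod_cast goldenMoment_mul_le hp m n)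
    (fun m n => by exact_mod_cast goldenMoment_add_le hp m n)
  have hr1 : 1 < r := by
    have := (htwo 1).trans (hr 1).2
    norm_num at this
    linarith
  have hphi : phi = φ := rfl
  have hφ := Real.one_lt_goldenRatio
  have hexp : 0 ≤ Real.log r / Real.log φ :=
    div_nonneg (Real.log_nonneg hr1.le) (Real.log_nonneg hφ.le)
  have hK : (1 : ℝ) ≤ 7 ^ p := one_le_pow₀ (by norm_num)
  refine ⟨r, hr1, (7 ^ p * r ^ 3)⁻¹, r, by positivity, ?_, 3, fun N hN => ?_⟩
  · exact (inv_le_one_of_one_le₀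
      (one_le_mul_of_one_le_of_one_le hK (one_le_pow₀ hr1.le))).trans hr1.le
  rw [hphi]
  have hN3 : (3 : ℝ) ≤ N := by exact_mod_cast hN
  obtain ⟨k, hk1, hk2⟩ := exists_nat_pow_near (x := (N : ℝ) / φ ^ 2) (y := φ)
    (by rw [one_le_div (by positivity)]; linarith [Real.goldenRatio_sq, Real.goldenRatio_lt_two]) hφ
  rw [le_div_iff₀ (by positivity), ← pow_add] at hk1
  rw [div_lt_iff₀ (by positivity), ← pow_add] at hk2
  have hfib1 : Nat.fib (k + 3) ≤ N := by
    exact_mod_cast (fib_succ_le_goldenRatio_pow (k + 2)).trans hk1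
  have hfib2 : N ≤ Nat.fib (k + 3 + 2) := by
    exact_mod_cast hk2.le.trans (goldenRatio_pow_le_fib (k + 3))
  have hlow : (goldenMoment p k : ℝ) ≤ SF p N := by
    exact_mod_cast (goldenMoment_le_SF hp k).trans (SF_mono p hfib1)
  have hupp : (SF p N : ℝ) ≤ goldenMoment p (k + 3) := by
    exact_mod_cast (SF_mono p hfib2).trans (SF_le_goldenMoment hp (k + 3))
  have hN1 : r ^ (k + 2) ≤ (N : ℝ) ^ (Real.log r / Real.log φ) := by
    rw [← pow_rpow_log_div_log hφ hr0]
    gcongr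
  have hN2 : (N : ℝ) ^ (Real.log r / Real.log φ) ≤ r ^ (k + 3) := by
    rw [← pow_rpow_log_div_log hφ hr0]
    gcongr
  constructor
  · rw [inv_mul_le_iff₀ (by positivity)]
    calc _ ≤ r ^ (k + 3) := hN2
      _ = r ^ k * r ^ 3 := pow_add _ _ _
      _ ≤ (7 ^ p * goldenMoment p k) * r ^ 3 := by gcongr; exact (hr k).1
      _ ≤ (7 ^ p * SF p N) * r ^ 3 := by gcongr
      _ = _ := by ring
  · calc (SF p N : ℝ) ≤ goldenMoment p (k + 3) := hupp
      _ ≤ r ^ (k + 3) := (hr (k + 3)).2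
      _ = r * r ^ (k + 2) := pow_succ' _ _
      _ ≤ _ := by gcongr
end

section
/- For every positive integer p there exist a real number c_p > 0 and a real number λ_p > 1 such that S_F^{(p)}(f_{ℓ+1}) ∼ c_p · λ_p^ℓ as ℓ → ∞, i.e., lim_{ℓ→∞} S_F^{(p)}(f_{ℓ+1}) / (c_p λ_p^ℓ) = 1. -/
/-- Perron's theorem: a nonnegative operator, some power of which is entrywise at least `1`,
has a positive eigenvector. -/
theorem exists_pos_eigenvector {ι : Type*} [Fintype ι] [Nonempty ι]
    (T : (ι → ℝ) →ₗ[ℝ] (ι → ℝ)) (hT : ∀ x, 0 ≤ x → 0 ≤ T x) (m : ℕ)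
    (hm : ∀ x, 0 ≤ x → ∀ i j, x j ≤ (T ^ m) x i) :
    ∃ w : ι → ℝ, ∃ lam : ℝ, (∀ i, 0 < w i) ∧ T w = lam • w := by
  classical
  have hcont : Continuous T := T.continuous_of_finiteDimensional
  have hsum_cont : Continuous fun x : ι → ℝ => ∑ i, T x i :=
    continuous_finsetSum _ fun i _ => (continuous_apply i).comp hcont
  have hpos : ∀ x : ι → ℝ, 0 ≤ x → x ≠ 0 → ∀ i, 0 < (T ^ m) x i := by
    intro x hx hx0 i
    obtain ⟨j, hj⟩ := Function.ne_iff.mp hx0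
    exact ((hx j).lt_of_ne' hj).trans_le (hm x hx i j)
  have hmem_ne : ∀ x ∈ stdSimplex ℝ ι, x ≠ 0 := by
    rintro x hx rfl
    simpa using hx.2
  obtain ⟨M, hM⟩ := ((isCompact_stdSimplex ℝ ι).image hsum_cont).bddAbove
  have hbound : ∀ t : ℝ, ∀ x ∈ stdSimplex ℝ ι, t • x ≤ T x → t ≤ M := by
    intro t x hx h
    have h1 : ∑ i, (t • x) i ≤ ∑ i, T x i := Finset.sum_le_sum fun i _ => h i
    have h2 : ∑ i, (t • x) i = t := by simp [← Finset.mul_sum, hx.2]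
    exact h2 ▸ h1.trans (hM ⟨x, hx, rfl⟩)
  let C : Set (ℝ × (ι → ℝ)) := (Set.Icc 0 M ×ˢ stdSimplex ℝ ι) ∩ {q | q.1 • q.2 ≤ T q.2}
  have hC : IsCompact C :=
    (isCompact_Icc.prod (isCompact_stdSimplex ℝ ι)).inter_right
      (isClosed_le (continuous_fst.smul continuous_snd) (hcont.comp continuous_snd))
  have hCne : C.Nonempty := by
    have hs : Pi.single (Classical.arbitrary ι) (1 : ℝ) ∈ stdSimplex ℝ ι := single_mem_stdSimplex _ _
    have h0 : (0 : ℝ) • (Pi.single (Classical.arbitrary ι) (1 : ℝ) : ι → ℝ) ≤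
        T (Pi.single (Classical.arbitrary ι) (1 : ℝ)) := by
      rw [zero_smul]; exact hT _ fun i => hs.1 i
    exact ⟨(0, _), ⟨⟨le_rfl, hbound _ _ hs h0⟩, hs⟩, h0⟩
  obtain ⟨⟨lam, x⟩, ⟨⟨hlam, hx⟩, hle⟩, hmax⟩ := hC.exists_isMaxOn hCne continuous_fst.continuousOn
  simp only [Set.mem_ofPred_eq] at hle hx hlam
  have hx0 : (0 : ι → ℝ) ≤ x := fun i => hx.1 i
  have hcomm : ∀ z, T ((T ^ m) z) = (T ^ m) (T z) := fun z => by
    rw [← Module.End.mul_apply, ← Module.End.mul_apply, ← pow_succ', ← pow_succ]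
  have heig : T x = lam • x := by
    by_contra hne
    have hgap := hpos (T x - lam • x) (sub_nonneg.mpr hle) (sub_ne_zero.mpr hne)
    set y := (T ^ m) x with hy
    have hy0 : ∀ i, 0 < y i := hpos x hx0 (hmem_ne x hx)
    have hgap' : ∀ i, lam * y i < T y i := by
      intro i
      have := hgap i
      rw [map_sub, map_smul, ← hcomm, ← hy] at this
      simpa using this
    obtain ⟨i₀, -, hi₀⟩ := Finset.exists_min_image Finset.univ (fun i => T y i / y i)
      Finset.univ_nonempty
    have hσ : 0 < ∑ i, y i := Finset.sum_pos (fun i _ => hy0 i) Finset.univ_nonempty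
    have hlt : lam < T y i₀ / y i₀ := (lt_div_iff₀ (hy0 i₀)).mpr (hgap' i₀)
    have hzs : (∑ i, y i)⁻¹ • y ∈ stdSimplex ℝ ι := by
      refine ⟨fun i => mul_nonneg (inv_nonneg.mpr hσ.le) (hy0 i).le, ?_⟩
      simp [← Finset.mul_sum, inv_mul_cancel₀ hσ.ne']
    have hzle : (T y i₀ / y i₀) • (∑ i, y i)⁻¹ • y ≤ T ((∑ i, y i)⁻¹ • y) := by
      intro i
      rw [map_smul, smul_comm]
      refine mul_le_mul_of_nonneg_left ?_ (inv_nonneg.mpr hσ.le)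
      exact (le_div_iff₀ (hy0 i)).mp (hi₀ i (Finset.mem_univ i))
    have := hmax (show (T y i₀ / y i₀, (∑ i, y i)⁻¹ • y) ∈ C from
      ⟨⟨⟨hlam.1.trans hlt.le, hbound _ _ hzs hzle⟩, hzs⟩, hzle⟩)
    exact absurd hlt (not_lt.mpr this)
  have hpow : ∀ k : ℕ, (T ^ k) x = lam ^ k • x := by
    intro k
    induction k with
    | zero => simp
    | succ k ih => rw [pow_succ', Module.End.mul_apply, ih, map_smul, heig, smul_smul, pow_succ]
  have hBx : ∀ i, 0 < lam ^ m * x i := by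
    intro i
    have := hpos x hx0 (hmem_ne x hx) i
    rwa [hpow m] at this
  have hxpos : ∀ i, 0 < x i := fun i => pos_of_mul_pos_right (hBx i) (pow_nonneg hlam.1 m)
  exact ⟨x, lam, hxpos, heig⟩

open Filter Topology in
/-- Powers of a nonnegative operator fixing `w > 0`, some power of which is entrywise bounded
below, send positive vectors to vectors converging to a multiple of `w`. -/
theorem exists_tendsto_pow_apply_of_fixed {ι : Type*} [Fintype ι] [Nonempty ι]
    (S : (ι → ℝ) →ₗ[ℝ] (ι → ℝ)) (hS : ∀ x, 0 ≤ x → 0 ≤ S x) (m : ℕ) {c : ℝ} (hc : 0 < c)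
    (hm : ∀ x, 0 ≤ x → ∀ i j, c * x j ≤ (S ^ m) x i) {w : ι → ℝ} (hw : ∀ i, 0 < w i)
    (hSw : S w = w) {v : ι → ℝ} (hv : ∀ i, 0 < v i) :
    ∃ a : ℝ, 0 < a ∧ ∀ i, Tendsto (fun n => (S ^ n) v i) atTop (𝓝 (a * w i)) := by
  let q : ℕ → ι → ℝ := fun n i => (S ^ n) v i / w i
  let lo : ℕ → ℝ := fun n => Finset.univ.inf' Finset.univ_nonempty (q n)
  let hi : ℕ → ℝ := fun n => Finset.univ.sup' Finset.univ_nonempty (q n)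
  have lo_le : ∀ n i, lo n ≤ q n i := fun n i => Finset.inf'_le _ (Finset.mem_univ i)
  have le_hi : ∀ n i, q n i ≤ hi n := fun n i => Finset.le_sup' _ (Finset.mem_univ i)
  have lo_mul : ∀ n i, lo n * w i ≤ (S ^ n) v i := fun n i => (le_div_iff₀ (hw i)).mp (lo_le n i)
  have mul_hi : ∀ n i, (S ^ n) v i ≤ hi n * w i := fun n i => (div_le_iff₀ (hw i)).mp (le_hi n i)
  have hSk : ∀ k, (S ^ k) w = w := by
    intro k
    induction k with
    | zero => simp
    | succ k ih => rw [pow_succ', Module.End.mul_apply, ih, hSw]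
  have hstep : ∀ n, (S ^ (n + 1)) v = S ((S ^ n) v) := fun n => by
    rw [pow_succ', Module.End.mul_apply]
  have lo_mono : Monotone lo := by
    refine monotone_nat_of_le_succ fun n => Finset.le_inf' _ _ fun i _ => ?_
    rw [le_div_iff₀ (hw i), hstep]
    have := hS ((S ^ n) v - lo n • w) (fun i => sub_nonneg.mpr (lo_mul n i)) i
    rw [map_sub, map_smul, hSw] at this
    simpa using this
  have hi_anti : Antitone hi := by
    refine antitone_nat_of_succ_le fun n => Finset.sup'_le _ _ fun i _ => ?_
    rw [div_le_iff₀ (hw i), hstep]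
    have := hS (hi n • w - (S ^ n) v) (fun i => sub_nonneg.mpr (mul_hi n i)) i
    rw [map_sub, map_smul, hSw] at this
    simpa using this
  have lo_le_hi : ∀ n, lo n ≤ hi n := fun n =>
    (lo_le n (Classical.arbitrary ι)).trans (le_hi n _)
  obtain ⟨imin, -, himin⟩ := Finset.exists_min_image Finset.univ w Finset.univ_nonempty
  obtain ⟨imax, -, himax⟩ := Finset.exists_max_image Finset.univ w Finset.univ_nonempty
  set d : ℝ := c * w imin / w imax with hd
  have hd0 : 0 < d := div_pos (mul_pos hc (hw _)) (hw _)
  have hcontract : ∀ n, lo n + d * (hi n - lo n) ≤ lo (n + m) := by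
    intro n
    refine Finset.le_inf' _ _ fun i _ => ?_
    obtain ⟨j, -, hj⟩ := Finset.exists_mem_eq_sup' Finset.univ_nonempty (q n)
    have hj' : (S ^ n) v j = hi n * w j := by
      rw [show hi n = q n j from hj, div_mul_cancel₀ _ (hw j).ne']
    have h1 := hm ((S ^ n) v - lo n • w) (fun i => sub_nonneg.mpr (lo_mul n i)) i j
    rw [map_sub, map_smul, hSk, ← Module.End.mul_apply, ← pow_add, add_comm m n] at h1
    simp only [Pi.sub_apply, Pi.smul_apply, smul_eq_mul, hj'] at h1
    rw [le_div_iff₀ (hw i)]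
    have h2 : d * w i ≤ c * w j := by
      calc d * w i ≤ d * w imax := mul_le_mul_of_nonneg_left (himax i (Finset.mem_univ i)) hd0.le
        _ = c * w imin := by rw [hd, div_mul_cancel₀ _ (hw _).ne']
        _ ≤ c * w j := mul_le_mul_of_nonneg_left (himin j (Finset.mem_univ j)) hc.le
    have h3 := mul_le_mul_of_nonneg_left h2 (sub_nonneg.mpr (lo_le_hi n))
    linarith
  obtain ⟨a, ha⟩ : ∃ a, Tendsto lo atTop (𝓝 a) := ⟨_, tendsto_atTop_ciSup lo_mono
    ⟨hi 0, by rintro _ ⟨n, rfl⟩; exact (lo_le_hi n).trans (hi_anti (Nat.zero_le n))⟩⟩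
  obtain ⟨b, hb⟩ : ∃ b, Tendsto hi atTop (𝓝 b) := ⟨_, tendsto_atTop_ciInf hi_anti
    ⟨lo 0, by rintro _ ⟨n, rfl⟩; exact (lo_mono (Nat.zero_le n)).trans (lo_le_hi n)⟩⟩
  have hab : a ≤ b := le_of_tendsto_of_tendsto' ha hb lo_le_hi
  have hlim : a + d * (b - a) ≤ a :=
    le_of_tendsto_of_tendsto' (ha.add ((hb.sub ha).const_mul d))
      ((tendsto_add_atTop_iff_nat m).mpr ha) hcontract
  obtain rfl : a = b := by nlinarith
  have hlo0 : 0 < lo 0 := (Finset.lt_inf'_iff _).mpr fun i _ => by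
    simpa [q] using div_pos (hv i) (hw i)
  refine ⟨a, hlo0.trans_le (lo_mono.ge_of_tendsto ha 0), fun i => ?_⟩
  exact tendsto_of_tendsto_of_tendsto_of_le_of_le (ha.mul_const (w i)) (hb.mul_const (w i))
    (fun n => lo_mul n i) (fun n => mul_hi n i)

/-- The number of ways to write `n` as a sum of distinct terms among `fibS 1, …, fibS l`. -/
def fibReps : ℕ → ℕ → ℕ
  | 0, n => if n = 0 then 1 else 0
  | l + 1, n => fibReps l n + if fibS (l + 1) ≤ n then fibReps l (n - fibS (l + 1)) else 0

theorem fibS_add_two {l : ℕ} (hl : 0 < l) : fibS (l + 2) = fibS (l + 1) + fibS l := by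
  obtain ⟨k, rfl⟩ := Nat.exists_eq_succ_of_ne_zero hl.ne'
  rfl

theorem fibS_pos {l : ℕ} (hl : 0 < l) : 0 < fibS l := by
  induction l using Nat.strong_induction_on with
  | _ l ih =>
    match l, hl with
    | 1, _ => simp [fibS]
    | 2, _ => simp [fibS]
    | k + 3, _ => exact Nat.add_pos_left (ih (k + 2) (by omega) (by omega)) _

theorem fibS_mono : Monotone fibS := by
  refine monotone_nat_of_le_succ fun n => ?_
  match n with
  | 0 => simp [fibS]
  | 1 => simp [fibS]
  | k + 2 => simp [fibS]

theorem fibReps_eq_card (l n : ℕ) :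
    fibReps l n = ((Finset.Icc 1 l).powerset.filter fun S => ∑ i ∈ S, fibS i = n).card := by
  induction l generalizing n with
  | zero => by_cases h : n = 0 <;> simp [fibReps, Finset.filter_singleton, h, eq_comm]
  | succ l ih =>
    have hnot : l + 1 ∉ Finset.Icc 1 l := by simp
    rw [← Finset.insert_Icc_right_eq_Icc_add_one (by omega), Finset.powerset_insert,
      Finset.filter_union, Finset.card_union_of_disjoint, fibReps, ih]
    · congr 1
      rw [Finset.filter_image, Finset.card_image_of_injOn]
      · split_ifs with h
        · rw [ih]
          congr 1
          refine Finset.filter_congr fun S hS => ?_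
          have : l + 1 ∉ S := fun h' => hnot (Finset.mem_powerset.mp hS h')
          rw [Finset.sum_insert this]
          omega
        · symm
          rw [Finset.card_eq_zero, Finset.filter_eq_empty_iff]
          intro S hS
          have : l + 1 ∉ S := fun h' => hnot (Finset.mem_powerset.mp hS h')
          rw [Finset.sum_insert this]
          omega
      · intro S hS S' hS' h
        have h1 : l + 1 ∉ S := fun h' =>
          hnot (Finset.mem_powerset.mp (Finset.mem_filter.mp hS).1 h')
        have h2 : l + 1 ∉ S' := fun h' =>
          hnot (Finset.mem_powerset.mp (Finset.mem_filter.mp hS').1 h')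
        rw [← Finset.erase_insert h1, ← Finset.erase_insert h2, h]
    · refine Finset.disjoint_filter_filter (Finset.disjoint_left.mpr fun S hS hS' => ?_)
      obtain ⟨S', -, rfl⟩ := Finset.mem_image.mp hS'
      exact hnot (Finset.mem_powerset.mp hS (Finset.mem_insert_self _ _))

theorem rF_eq_fibReps {l n : ℕ} (h : n < fibS (l + 1)) : rF n = fibReps l n := by
  rw [fibReps_eq_card, rF, Nat.subtype_card]
  intro S
  rw [Finset.mem_filter, Finset.mem_powerset]
  refine and_congr_left fun hS => ⟨fun hsub h0 => by simpa using hsub h0, fun h0 i hi => ?_⟩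
  rw [Finset.mem_Icc]
  refine ⟨Nat.pos_of_ne_zero fun h' => h0 (h' ▸ hi), ?_⟩
  by_contra! hlt
  have h1 : fibS i ≤ n := hS ▸ Finset.single_le_sum (f := fibS) (fun _ _ => Nat.zero_le _) hi
  have h2 : fibS (l + 1) ≤ fibS i := fibS_mono hlt
  omega

theorem fibReps_eq_zero {l n : ℕ} (h : fibS (l + 2) ≤ n + 1) : fibReps l n = 0 := by
  induction l generalizing n with
  | zero =>
    have : n ≠ 0 := by simp [fibS] at h; omega
    simp [fibReps, this]
  | succ l ih =>
    have h1 : fibS (l + 1 + 2) = fibS (l + 2) + fibS (l + 1) := rfl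
    rw [fibReps, ih (by omega), zero_add]
    split_ifs
    · exact ih (by omega)
    · rfl

theorem fibReps_of_lt {l n : ℕ} (h : n < fibS (l + 1)) : fibReps (l + 1) n = fibReps l n := by
  simp [fibReps, Nat.not_le.mpr h]

theorem fibReps_add_fibS (l n : ℕ) :
    fibReps (l + 1) (n + fibS (l + 1)) = fibReps l (n + fibS (l + 1)) + fibReps l n := by
  simp [fibReps]

theorem fibReps_add_fibS_succ {k n : ℕ} (hk : 0 < k) :
    fibReps (k + 1) (n + fibS (k + 2)) = fibReps k (n + fibS k) := by
  have h := fibS_add_two hk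
  rw [show n + fibS (k + 2) = n + fibS k + fibS (k + 1) by omega, fibReps_add_fibS,
    fibReps_eq_zero (by omega), zero_add]

theorem fibReps_zero_pos (l : ℕ) : 0 < fibReps l 0 := by
  induction l with
  | zero => simp [fibReps]
  | succ l ih => exact Nat.add_pos_left ih _

/-- The moments of the pair `(fibReps l n, fibReps l (n + fibS l))` for `n < fibS (l + 1)`. -/
def fibMoment (p l i : ℕ) : ℕ :=
  ∑ n ∈ Finset.range (fibS (l + 1)), fibReps l n ^ (p - i) * fibReps l (n + fibS l) ^ i

/-- The transition coefficients of the moments `fibMoment`. -/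
def momentCoeff (p i j : ℕ) : ℕ :=
  (if j = 0 then 0 else i.choose j) + if i ≤ j then (p - i).choose (j - i) else 0

theorem SF_fibS (p l : ℕ) : SF p (fibS (l + 1)) = fibMoment p l 0 := by
  refine Finset.sum_congr rfl fun n hn => ?_
  rw [rF_eq_fibReps (Finset.mem_range.mp hn)]
  simp

theorem fibMoment_pos (p : ℕ) {l i : ℕ} (hl : 0 < l) : 0 < fibMoment p l i := by
  obtain ⟨k, rfl⟩ := Nat.exists_eq_succ_of_ne_zero hl.ne'
  have h0 : 0 < fibReps (k + 1) (0 + fibS (k + 1)) := by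
    rw [fibReps_add_fibS]
    exact Nat.add_pos_right _ (fibReps_zero_pos k)
  refine Finset.sum_pos' (fun _ _ => Nat.zero_le _)
    ⟨0, Finset.mem_range.mpr (fibS_pos (by omega)), ?_⟩
  exact Nat.mul_pos (Nat.pow_pos (fibReps_zero_pos _)) (Nat.pow_pos h0)

theorem fibMoment_add_two (p : ℕ) {k i : ℕ} (hk : 0 < k) (hi : i ≤ p) :
    fibMoment p (k + 2) i = fibMoment p (k + 1) 0 +
      ∑ j ∈ Finset.range (p + 1), momentCoeff p i j * fibMoment p k j := by
  have hF2 := fibS_add_two hk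
  have hF3 : fibS (k + 3) = fibS (k + 2) + fibS (k + 1) := rfl
  have hlow : ∀ n ∈ Finset.range (fibS (k + 2)),
      fibReps (k + 2) n ^ (p - i) * fibReps (k + 2) (n + fibS (k + 2)) ^ i =
      ∑ j ∈ Finset.range (p + 1), i.choose j *
        (fibReps (k + 1) n ^ (p - j) * fibReps (k + 1) (n + fibS (k + 2)) ^ j) := by
    intro n hn
    rw [fibReps_of_lt (Finset.mem_range.mp hn), fibReps_add_fibS, add_pow, Finset.mul_sum]
    refine Finset.sum_subset_zero_on_sdiff (by simpa using hi) (fun j hj => ?_) fun j hj => ?_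
    · simp only [Finset.mem_sdiff, Finset.mem_range] at hj
      rw [Nat.choose_eq_zero_of_lt (by omega), zero_mul]
    · have hj' : j ≤ i := by simpa [Nat.lt_succ_iff] using hj
      rw [show p - j = (p - i) + (i - j) by omega, pow_add]
      push_cast
      ring
  have hhigh : ∀ n ∈ Finset.range (fibS (k + 1)),
      fibReps (k + 2) (fibS (k + 2) + n) ^ (p - i) *
        fibReps (k + 2) (fibS (k + 2) + n + fibS (k + 2)) ^ i =
      ∑ j ∈ Finset.range (p + 1), (if i ≤ j then (p - i).choose (j - i) else 0) *
        (fibReps k n ^ (p - j) * fibReps k (n + fibS k) ^ j) := by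
    intro n hn
    rw [fibReps_add_fibS, add_comm (fibS (k + 2)) n, fibReps_add_fibS, fibReps_add_fibS_succ hk,
      fibReps_of_lt (Finset.mem_range.mp hn),
      fibReps_eq_zero (l := k + 1) (n := n + fibS (k + 2) + fibS (k + 2))
        (by change fibS (k + 3) ≤ _; have := fibS_mono (show k + 1 ≤ k + 2 by omega); omega),
      zero_add]
    obtain ⟨q, rfl⟩ := Nat.exists_eq_add_of_le hi
    rw [add_assoc i q 1, Finset.sum_range_add, Finset.sum_eq_zero, zero_add,
      Nat.add_sub_cancel_left, add_pow, Finset.sum_mul]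
    · refine Finset.sum_congr rfl fun j hj => ?_
      rw [if_pos (by omega), Nat.add_sub_cancel_left, show i + q - (i + j) = q - j by omega]
      simp only [Nat.cast_id, pow_add]
      ring
    · intro j hj
      rw [if_neg (by simpa using hj), zero_mul]
  have hmid : ∀ j, j ≠ 0 → ∑ n ∈ Finset.range (fibS (k + 2)),
      fibReps (k + 1) n ^ (p - j) * fibReps (k + 1) (n + fibS (k + 2)) ^ j = fibMoment p k j := by
    intro j hj
    rw [hF2, Finset.sum_range_add, ← hF2, fibMoment, Finset.sum_eq_zero (s := Finset.range (fibS k)),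
      add_zero]
    · refine Finset.sum_congr rfl fun n hn => ?_
      rw [fibReps_of_lt (Finset.mem_range.mp hn), fibReps_add_fibS_succ hk]
    · intro n _
      rw [fibReps_eq_zero (l := k + 1) (n := fibS (k + 1) + n + fibS (k + 2))
        (by change fibS (k + 3) ≤ _; omega), zero_pow hj, mul_zero]
  have hzero : fibMoment p (k + 1) 0 = ∑ n ∈ Finset.range (fibS (k + 2)),
      fibReps (k + 1) n ^ (p - 0) * fibReps (k + 1) (n + fibS (k + 2)) ^ 0 := by
    simp [fibMoment]
  have hlow_sum : ∑ j ∈ Finset.range (p + 1), i.choose j * (∑ n ∈ Finset.range (fibS (k + 2)),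
      fibReps (k + 1) n ^ (p - j) * fibReps (k + 1) (n + fibS (k + 2)) ^ j) =
      fibMoment p (k + 1) 0 + ∑ j ∈ Finset.range (p + 1),
        (if j = 0 then 0 else i.choose j) * fibMoment p k j := by
    rw [Finset.sum_range_succ', Finset.sum_range_succ' _ p, Nat.choose_zero_right, one_mul, ← hzero]
    simp only [Nat.add_eq_zero_iff, one_ne_zero, and_false, if_false, if_true, zero_mul, add_zero]
    rw [add_comm]
    congr 1
    exact Finset.sum_congr rfl fun j _ => by rw [hmid (j + 1) (by omega)]
  have hhigh_sum : ∀ j, ∑ n ∈ Finset.range (fibS (k + 1)),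
      fibReps k n ^ (p - j) * fibReps k (n + fibS k) ^ j = fibMoment p k j := fun _ => rfl
  rw [fibMoment, show fibS (k + 2 + 1) = fibS (k + 2) + fibS (k + 1) from rfl,
    Finset.sum_range_add, Finset.sum_congr rfl hlow, Finset.sum_congr rfl hhigh,
    Finset.sum_comm, Finset.sum_comm (s := Finset.range (fibS (k + 1)))]
  simp only [← Finset.mul_sum, hhigh_sum]
  rw [hlow_sum, add_assoc, ← Finset.sum_add_distrib]
  simp only [momentCoeff, add_mul]

/-- The operator sending `(fibMoment p (l + 1), fibMoment p l)` to the next such pair. -/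
noncomputable def momentStep (p : ℕ) :
    (Fin (p + 1) ⊕ Fin (p + 1) → ℝ) →ₗ[ℝ] (Fin (p + 1) ⊕ Fin (p + 1) → ℝ) where
  toFun x := Sum.elim
    (fun i => x (.inl 0) + ∑ j : Fin (p + 1), (momentCoeff p i j : ℝ) * x (.inr j))
    (fun i => x (.inl i))
  map_add' x y := by
    ext (i | i)
    · simp only [Sum.elim_inl, Pi.add_apply, mul_add, Finset.sum_add_distrib]
      ring
    · rfl
  map_smul' r x := by
    ext (i | i)
    · simp only [Sum.elim_inl, Pi.smul_apply, smul_eq_mul, RingHom.id_apply, mul_add,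
        Finset.mul_sum, mul_left_comm]
    · rfl

theorem momentStep_inl (p : ℕ) (x : Fin (p + 1) ⊕ Fin (p + 1) → ℝ) (i : Fin (p + 1)) :
    momentStep p x (.inl i) =
      x (.inl 0) + ∑ j : Fin (p + 1), (momentCoeff p i j : ℝ) * x (.inr j) := rfl

theorem momentStep_inr (p : ℕ) (x : Fin (p + 1) ⊕ Fin (p + 1) → ℝ) (i : Fin (p + 1)) :
    momentStep p x (.inr i) = x (.inl i) := rfl

theorem le_momentStep_inl (p : ℕ) {x : Fin (p + 1) ⊕ Fin (p + 1) → ℝ} (hx : 0 ≤ x)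
    (i : Fin (p + 1)) : x (.inl 0) ≤ momentStep p x (.inl i) :=
  le_add_of_nonneg_right (Finset.sum_nonneg fun j _ => mul_nonneg (Nat.cast_nonneg _) (hx _))

theorem momentStep_nonneg (p : ℕ) (x : Fin (p + 1) ⊕ Fin (p + 1) → ℝ) (hx : 0 ≤ x) :
    0 ≤ momentStep p x := by
  rintro (i | i)
  · exact (hx (.inl 0)).trans (le_momentStep_inl p hx i)
  · exact hx (.inl i)

theorem add_le_momentStep_inl_zero (p : ℕ) {x : Fin (p + 1) ⊕ Fin (p + 1) → ℝ} (hx : 0 ≤ x)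
    (j : Fin (p + 1)) : x (.inl 0) + x (.inr j) ≤ momentStep p x (.inl 0) := by
  rw [momentStep_inl]
  refine add_le_add_right ?_ _
  have hcoeff : 1 ≤ momentCoeff p 0 j :=
    Nat.le_add_left_of_le (by simpa using Nat.succ_le_of_lt (Nat.choose_pos (Nat.lt_succ_iff.mp j.2)))
  calc x (.inr j) ≤ (momentCoeff p (0 : Fin (p + 1)) j : ℝ) * x (.inr j) :=
        le_mul_of_one_le_left (hx _) (by exact_mod_cast hcoeff)
    _ ≤ _ := Finset.single_le_sum
        (f := fun j : Fin (p + 1) => (momentCoeff p (0 : Fin (p + 1)) j : ℝ) * x (.inr j))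
        (fun j _ => mul_nonneg (Nat.cast_nonneg _) (hx _)) (Finset.mem_univ _)

theorem le_momentStep_pow_four (p : ℕ) (x : Fin (p + 1) ⊕ Fin (p + 1) → ℝ) (hx : 0 ≤ x)
    (i j : Fin (p + 1) ⊕ Fin (p + 1)) : x j ≤ (momentStep p ^ 4) x i := by
  have h1 := momentStep_nonneg p x hx
  have h2 := momentStep_nonneg p _ h1
  have h3 := momentStep_nonneg p _ h2
  have hj : x j ≤ momentStep p (momentStep p x) (.inl 0) := by
    obtain j | j := j
    · exact (le_add_of_nonneg_left (h1 _)).trans (add_le_momentStep_inl_zero p h1 j)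
    · exact (le_add_of_nonneg_left (hx _)).trans
        ((add_le_momentStep_inl_zero p hx j).trans (le_momentStep_inl p h1 0))
  simp only [pow_succ, pow_zero, one_mul, Module.End.mul_apply]
  refine hj.trans ?_
  obtain i | i := i
  · exact (le_momentStep_inl p h2 0).trans (le_momentStep_inl p h3 i)
  · exact le_momentStep_inl p h2 i

theorem momentStep_pow_fibMoment (p n : ℕ) :
    (momentStep p ^ n) (Sum.elim (fun i => (fibMoment p 2 i : ℝ)) fun i => (fibMoment p 1 i : ℝ)) =
      Sum.elim (fun i : Fin (p + 1) => (fibMoment p (n + 2) i : ℝ))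
        fun i : Fin (p + 1) => (fibMoment p (n + 1) i : ℝ) := by
  induction n with
  | zero => simp
  | succ n ih =>
    rw [pow_succ', Module.End.mul_apply, ih]
    ext (i | i)
    · rw [momentStep_inl, Sum.elim_inl, Sum.elim_inl, fibMoment_add_two p (Nat.succ_pos n)
        (Nat.lt_succ_iff.mp i.2), Finset.sum_range]
      push_cast
      rfl
    · rfl

theorem SF_at_fib_asymp_equiv (p : ℕ) (hp : 0 < p) :
    ∃ c : ℝ, 0 < c ∧ ∃ lam : ℝ, 1 < lam ∧
      Filter.Tendsto (fun ℓ : ℕ => (SF p (fibS (ℓ + 1)) : ℝ) / (c * lam ^ ℓ))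
        Filter.atTop (nhds 1) := by
  obtain ⟨w, lam, hw, hlam⟩ := exists_pos_eigenvector (momentStep p) (momentStep_nonneg p) 4
    (le_momentStep_pow_four p)
  have hlam1 : 1 < lam := by
    have h1 := add_le_momentStep_inl_zero p (fun i => (hw i).le) 0
    have h2 : momentStep p w (.inl 0) = lam * w (.inl 0) := by rw [hlam]; rfl
    have h3 := hw (.inr 0)
    exact lt_of_mul_lt_mul_right (by linarith : 1 * w (.inl 0) < lam * w (.inl 0)) (hw _).le
  have hlam0 : 0 < lam := one_pos.trans hlam1
  obtain ⟨a, ha, hlim⟩ := exists_tendsto_pow_apply_of_fixed (lam⁻¹ • momentStep p)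
    (fun x hx => smul_nonneg (inv_nonneg.mpr hlam0.le) (momentStep_nonneg p x hx)) 4
    (pow_pos (inv_pos.mpr hlam0) 4)
    (fun x hx i j => by
      rw [smul_pow]
      exact mul_le_mul_of_nonneg_left (le_momentStep_pow_four p x hx i j) (by positivity))
    hw (by rw [LinearMap.smul_apply, hlam, inv_smul_smul₀ hlam0.ne'])
    (v := Sum.elim (fun i => (fibMoment p 2 i : ℝ)) fun i => (fibMoment p 1 i : ℝ))
    (by rintro (i | i) <;> exact Nat.cast_pos.mpr (fibMoment_pos p (by norm_num)))
  have hc : 0 < a * w (.inr 0) := mul_pos ha (hw _)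
  refine ⟨a * w (.inr 0) / lam, div_pos hc hlam0, lam, hlam1, ?_⟩
  rw [← Filter.tendsto_add_atTop_iff_nat 1]
  have h := (hlim (.inr 0)).div_const (a * w (.inr 0))
  rw [div_self hc.ne'] at h
  refine h.congr fun n => ?_
  rw [smul_pow, LinearMap.smul_apply, momentStep_pow_fibMoment, SF_fibS, Pi.smul_apply,
    Sum.elim_inr, smul_eq_mul, Fin.val_zero, inv_pow]
  field_simp
  ring
end

section
/- One has S_F^{(1)}(N) ≍ N^{(log 2)/(log φ)} as N → ∞; that is, there exist constants 0 < c ≤ C such that c · N^{(log 2)/(log φ)} ≤ ∑_{n=0}^{N−1} r_F(n) ≤ C · N^{(log 2)/(log φ)} for all sufficiently large N. -/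
theorem fibS_add_three (n : ℕ) : fibS (n + 3) = fibS (n + 2) + fibS (n + 1) := rfl

theorem fibS_le_succ (n : ℕ) : fibS n ≤ fibS (n + 1) := by
  match n with
  | 0 => decide
  | 1 => decide
  | n + 2 => rw [fibS_add_three]; omega

theorem self_le_fibS (n : ℕ) : n ≤ fibS n := by
  induction n using Nat.strong_induction_on with
  | _ n ih =>
    match n with
    | 0 => decide
    | 1 => decide
    | 2 => decide
    | n + 3 =>
      have h₁ := ih (n + 2) (by omega)
      have h₂ := ih (n + 1) (by omega)
      rw [fibS_add_three]
      omega

theorem sum_fibS_Icc (m : ℕ) : ∑ i ∈ Finset.Icc 1 m, fibS i + 2 = fibS (m + 2) := by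
  induction m with
  | zero => rfl
  | succ m ih =>
    rw [Finset.sum_Icc_succ_top (by omega), fibS_add_three, ← ih]
    omega

/-- Representations of numbers below `fibS (k + 1)` only use indices in `[1, k]`. -/
theorem rF_eq_card_filter {n k : ℕ} (h : n < fibS (k + 1)) :
    rF n = (((Finset.Icc 1 k).powerset).filter fun S => ∑ i ∈ S, fibS i = n).card := by
  rw [rF, ← Nat.card_eq_finsetCard]
  refine Nat.card_congr (Equiv.subtypeEquivRight fun S => ?_)
  rw [Finset.mem_filter, Finset.mem_powerset]
  refine and_congr_left fun hS => ⟨fun h0 i hi => ?_, fun hsub h0 => ?_⟩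
  · rw [Finset.mem_Icc]
    refine ⟨Nat.one_le_iff_ne_zero.2 fun hi0 => h0 (hi0 ▸ hi), ?_⟩
    by_contra! hk
    have h₁ : fibS i ≤ ∑ i ∈ S, fibS i :=
      Finset.single_le_sum (fun _ _ => Nat.zero_le _) hi
    have h₂ : fibS (k + 1) ≤ fibS i := fibS_mono hk
    omega
  · have := Finset.mem_Icc.1 (hsub h0)
    omega

theorem SF_one_eq_card_filter {N k : ℕ} (h : N ≤ fibS (k + 1)) :
    SF 1 N = (((Finset.Icc 1 k).powerset).filter fun S => ∑ i ∈ S, fibS i < N).card := by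
  rw [SF, Finset.card_eq_sum_card_fiberwise (f := fun S => ∑ i ∈ S, fibS i)
    (t := Finset.range N) (fun S hS => by simpa using (Finset.mem_filter.1 hS).2)]
  refine Finset.sum_congr rfl fun n hn => ?_
  have hn := Finset.mem_range.1 hn
  rw [pow_one, rF_eq_card_filter (hn.trans_le h), Finset.filter_filter]
  congr 1
  refine Finset.filter_congr fun S _ => ?_
  constructor
  · intro hS
    exact ⟨hS ▸ hn, hS⟩
  · exact fun hS => hS.2

theorem SF_one_le {N k : ℕ} (h : N ≤ fibS (k + 1)) : SF 1 N ≤ 2 ^ k := by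
  rw [SF_one_eq_card_filter h]
  refine (Finset.card_filter_le _ _).trans ?_
  simp

theorem le_SF_one {N m : ℕ} (h : fibS (m + 2) ≤ N) : 2 ^ m ≤ SF 1 N := by
  have hmN : m ≤ N := by
    have := self_le_fibS (m + 2)
    omega
  rw [SF_one_eq_card_filter (k := N) ((self_le_fibS N).trans (fibS_le_succ N))]
  calc 2 ^ m = ((Finset.Icc 1 m).powerset).card := by simp
    _ ≤ _ := by
      refine Finset.card_le_card fun S hS => ?_
      have hS := Finset.mem_powerset.1 hS
      rw [Finset.mem_filter, Finset.mem_powerset]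
      refine ⟨hS.trans (Finset.Icc_subset_Icc_right hmN), ?_⟩
      have h₁ : ∑ i ∈ S, fibS i ≤ ∑ i ∈ Finset.Icc 1 m, fibS i :=
        Finset.sum_le_sum_of_subset hS
      have h₂ := sum_fibS_Icc m
      omega

theorem phi_sq : phi ^ 2 = phi + 1 := Real.goldenRatio_sq

theorem one_lt_phi : 1 < phi := Real.one_lt_goldenRatio

theorem phi_lt_two : phi < 2 := Real.goldenRatio_lt_two

theorem phi_pow_le_fibS (n : ℕ) : phi ^ n ≤ fibS (n + 1) := by
  induction n using Nat.strong_induction_on with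
  | _ n ih =>
    match n with
    | 0 => simp [fibS]
    | 1 => simpa [fibS] using phi_lt_two.le
    | n + 2 =>
      have h₁ := ih (n + 1) (by omega)
      have h₂ := ih n (by omega)
      rw [fibS_add_three, pow_add, phi_sq]
      push_cast
      rw [pow_succ] at h₁
      linarith

theorem fibS_le_phi_pow (n : ℕ) : (fibS n : ℝ) ≤ phi ^ n := by
  induction n using Nat.strong_induction_on with
  | _ n ih =>
    match n with
    | 0 => simp [fibS]
    | 1 => simpa [fibS] using one_lt_phi.le
    | 2 =>
      have := one_lt_phi
      rw [phi_sq]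
      norm_num [fibS]
      linarith
    | n + 3 =>
      have h₁ := ih (n + 2) (by omega)
      have h₂ := ih (n + 1) (by omega)
      have h₃ : phi ^ (n + 3) = phi ^ (n + 2) + phi ^ (n + 1) := by
        linear_combination phi ^ (n + 1) * phi_sq
      rw [fibS_add_three, h₃]
      push_cast
      linarith

theorem phi_pow_rpow (n : ℕ) : (phi ^ n) ^ (Real.log 2 / Real.log phi) = 2 ^ n := by
  have h0 : 0 < phi := one_pos.trans one_lt_phi
  have hl : Real.log phi ≠ 0 := (Real.log_pos one_lt_phi).ne'
  rw [← Real.rpow_natCast, ← Real.rpow_mul h0.le, mul_comm, Real.rpow_mul h0.le,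
    Real.rpow_natCast, Real.rpow_def_of_pos h0, mul_div_cancel₀ _ hl, Real.exp_log two_pos]

theorem exists_fibS_le_lt {N : ℕ} (hN : 2 ≤ N) :
    ∃ m, fibS (m + 2) ≤ N ∧ N < fibS (m + 3) := by
  have hex : ∃ m, N < fibS (m + 3) := ⟨N, by have := self_le_fibS (N + 3); omega⟩
  classical
  refine ⟨Nat.find hex, ?_, Nat.find_spec hex⟩
  rcases hm : Nat.find hex with _ | m
  · exact hN
  · exact not_lt.1 (Nat.find_min hex (m := m) (by omega))

theorem SF_one_asymp :
    ∃ c C : ℝ, 0 < c ∧ c ≤ C ∧ ∃ N₀ : ℕ, ∀ N : ℕ, N₀ ≤ N →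
      c * (N : ℝ) ^ (Real.log 2 / Real.log phi) ≤ (SF 1 N : ℝ) ∧
      (SF 1 N : ℝ) ≤ C * (N : ℝ) ^ (Real.log 2 / Real.log phi) := by
  refine ⟨1 / 8, 2, by norm_num, by norm_num, 2, fun N hN => ?_⟩
  obtain ⟨m, hm₁, hm₂⟩ := exists_fibS_le_lt hN
  have hα : 0 ≤ Real.log 2 / Real.log phi :=
    div_nonneg (Real.log_nonneg one_le_two) (Real.log_pos one_lt_phi).le
  have hphi : 0 ≤ phi := zero_le_one.trans one_lt_phi.le
  have hlow : (2 : ℝ) ^ m ≤ SF 1 N := by exact_mod_cast le_SF_one hm₁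
  have hup : (SF 1 N : ℝ) ≤ 2 ^ (m + 2) := by exact_mod_cast SF_one_le hm₂.le
  have hN_up : (N : ℝ) ≤ phi ^ (m + 3) :=
    (Nat.cast_le.2 hm₂.le).trans (fibS_le_phi_pow _)
  have hN_low : phi ^ (m + 1) ≤ (N : ℝ) :=
    (phi_pow_le_fibS _).trans (Nat.cast_le.2 hm₁)
  have h₁ := Real.rpow_le_rpow (Nat.cast_nonneg N) hN_up hα
  have h₂ := Real.rpow_le_rpow (pow_nonneg hphi _) hN_low hα
  rw [phi_pow_rpow, pow_add] at h₁ h₂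
  rw [pow_add] at hup
  constructor <;> linarith
end
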